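/- Let f : R^d → R have L-Lipschitz gradient (in the ℓ_∞/ℓ_1 norm pair) and suppose ‖∇f(x)‖_0 ≤ s for all x (the gradient is s-sparse). Then the Gaussian-smoothed gradient satisfies ‖∇f_ν(x) − ∇f(x)‖_2 ≤ C ν L √(2s) (log d)^{3/2} for all x, with C the universal sup-norm Gaussian moment constant. -/

import Mathlib

open MeasureTheory ProbabilityTheory

section GradientLipschitz

variable {E : Type*} [NormedAddCommGroup E] [NormedSpace ℝ E] {f : E → ℝ} {L : ℝ}

theorem fderiv_sub_apply_le
    (hlip : ∀ x y, |f y - f x - fderiv ℝ f x (y - x)| ≤ L / 2 * ‖y - x‖ ^ 2) (x y w : E) :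
    (fderiv ℝ f y - fderiv ℝ f x) w
      ≤ L / 2 * (‖(2⁻¹ : ℝ) • (y - x) + w‖ ^ 2 + ‖(2⁻¹ : ℝ) • (y - x) - w‖ ^ 2) := by
  set h : E := (2⁻¹ : ℝ) • (y - x) with hh
  have hy : y = x + h + h := by
    rw [hh, add_assoc, ← add_smul]; norm_num
  have h1 := (abs_le.1 (hlip x (x + h + w))).2
  have h2 := (abs_le.1 (hlip y (x + h + w))).1
  have h3 := (abs_le.1 (hlip x (x + h - w))).1
  have h4 := (abs_le.1 (hlip y (x + h - w))).2
  have e1 : x + h + w - x = h + w := by abel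
  have e2 : x + h + w - y = -(h - w) := by rw [hy]; abel
  have e3 : x + h - w - x = h - w := by abel
  have e4 : x + h - w - y = -(h + w) := by rw [hy]; abel
  rw [e1] at h1
  rw [e2, norm_neg] at h2
  rw [e3] at h3
  rw [e4, norm_neg] at h4
  simp only [map_add, map_sub, map_neg] at h1 h2 h3 h4
  rw [sub_apply]
  linarith

/-- A two-sided quadratic bound on the first-order remainder makes the derivative
`2 * L`-Lipschitz for the dual norm. -/
theorem norm_fderiv_sub_le (hL : 0 ≤ L)
    (hlip : ∀ x y, |f y - f x - fderiv ℝ f x (y - x)| ≤ L / 2 * ‖y - x‖ ^ 2) (x y : E) :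
    ‖fderiv ℝ f y - fderiv ℝ f x‖ ≤ 2 * L * ‖y - x‖ := by
  rcases eq_or_ne y x with rfl | hne
  · simp
  have hpos : 0 < ‖y - x‖ := norm_pos_iff.2 (sub_ne_zero.2 hne)
  have upper : ∀ v : E, ‖v‖ = 1 →
      (fderiv ℝ f y - fderiv ℝ f x) v ≤ 2 * L * ‖y - x‖ := by
    intro v hv
    have key := fderiv_sub_apply_le hlip x y ((‖y - x‖ / 2) • v)
    have n1 : ‖(2⁻¹ : ℝ) • (y - x)‖ = ‖y - x‖ / 2 := by
      rw [norm_smul]; norm_num; ring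
    have n2 : ‖(‖y - x‖ / 2) • v‖ = ‖y - x‖ / 2 := by
      rw [norm_smul, hv, mul_one, Real.norm_of_nonneg (by positivity)]
    have b1 : ‖(2⁻¹ : ℝ) • (y - x) + (‖y - x‖ / 2) • v‖ ≤ ‖y - x‖ :=
      (norm_add_le _ _).trans (by rw [n1, n2]; linarith)
    have b2 : ‖(2⁻¹ : ℝ) • (y - x) - (‖y - x‖ / 2) • v‖ ≤ ‖y - x‖ :=
      (norm_sub_le _ _).trans (by rw [n1, n2]; linarith)
    have c1 := pow_le_pow_left₀ (norm_nonneg _) b1 2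
    have c2 := pow_le_pow_left₀ (norm_nonneg _) b2 2
    rw [map_smul, smul_eq_mul] at key
    have : ‖y - x‖ * (fderiv ℝ f y - fderiv ℝ f x) v ≤ ‖y - x‖ * (2 * L * ‖y - x‖) := by
      nlinarith [mul_le_mul_of_nonneg_left (add_le_add c1 c2) (by positivity : 0 ≤ L / 2)]
    exact le_of_mul_le_mul_left this hpos
  refine ContinuousLinearMap.opNorm_le_of_unit_norm (by positivity) fun v hv => ?_
  rw [Real.norm_eq_abs, abs_le]
  refine ⟨?_, upper v hv⟩
  have := upper (-v) (by rwa [norm_neg])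
  rw [map_neg] at this
  linarith

end GradientLipschitz

section Stein

/-- Stein's identity for the standard Gaussian on the line. -/
theorem integral_deriv_gaussianReal {g g' : ℝ → ℝ} (hg : ∀ t, HasDerivAt g (g' t) t)
    (h0 : Integrable g (gaussianReal 0 1)) (h1 : Integrable g' (gaussianReal 0 1))
    (h2 : Integrable (fun t => t * g t) (gaussianReal 0 1)) :
    ∫ t, g' t ∂(gaussianReal 0 1) = ∫ t, t * g t ∂(gaussianReal 0 1) := by
  have hint : ∀ k : ℝ → ℝ, Integrable k (gaussianReal 0 1) →
      Integrable (fun t => k t * gaussianPDFReal 0 1 t) volume := by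
    intro k hk
    rw [gaussianReal_of_var_ne_zero 0 one_ne_zero, integrable_withDensity_iff
      (measurable_gaussianPDF 0 1) (Filter.Eventually.of_forall fun _ => gaussianPDF_lt_top)] at hk
    simpa [toReal_gaussianPDF] using hk
  have hpdf : ∀ t : ℝ, HasDerivAt (gaussianPDFReal 0 1) (-t * gaussianPDFReal 0 1 t) t := by
    intro t
    have hsq : HasDerivAt (fun x : ℝ => -x ^ 2 / 2) (-t) t := by
      have := ((hasDerivAt_pow 2 t).neg).div_const 2
      refine this.congr_deriv ?_
      push_cast
      ring
    have heq : gaussianPDFReal 0 1 = fun x => (√(2 * Real.pi))⁻¹ * Real.exp (-x ^ 2 / 2) := by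
      rw [gaussianPDFReal_def]
      simp
    rw [heq]
    refine (hsq.exp.const_mul _).congr_deriv ?_
    ring
  have key := integral_mul_deriv_eq_deriv_mul_of_integrable (u := g) (u' := g')
    (v := gaussianPDFReal 0 1) (v' := fun t => -t * gaussianPDFReal 0 1 t)
    (fun t _ => hg t) (fun t _ => hpdf t)
    (by
      refine (hint _ h2).neg.congr (Filter.Eventually.of_forall fun t => ?_)
      simp only [Pi.neg_apply, Pi.mul_apply]; ring)
    (hint _ h1) (hint _ h0)
  rw [integral_gaussianReal_eq_integral_smul one_ne_zero,
    integral_gaussianReal_eq_integral_smul one_ne_zero]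
  simp only [smul_eq_mul]
  have e1 : ∫ t, gaussianPDFReal 0 1 t * g' t = ∫ t, g' t * gaussianPDFReal 0 1 t :=
    integral_congr_ae (Filter.Eventually.of_forall fun t => mul_comm _ _)
  rw [e1, ← neg_neg (∫ t, g' t * gaussianPDFReal 0 1 t), ← key, ← integral_neg]
  refine integral_congr_ae (Filter.Eventually.of_forall fun t => ?_)
  ring

/-- Stein's identity, in one coordinate of a standard Gaussian vector. -/
theorem integral_fderiv_pi_gaussianReal {d : ℕ} {h : (Fin d → ℝ) → ℝ} (hh : Differentiable ℝ h)
    (i : Fin d)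
    (h0 : Integrable h (Measure.pi fun _ : Fin d => gaussianReal 0 1))
    (h1 : Integrable (fun u => fderiv ℝ h u (Pi.single i 1))
      (Measure.pi fun _ : Fin d => gaussianReal 0 1))
    (h2 : Integrable (fun u => u i * h u) (Measure.pi fun _ : Fin d => gaussianReal 0 1)) :
    ∫ u, fderiv ℝ h u (Pi.single i 1) ∂(Measure.pi fun _ : Fin d => gaussianReal 0 1)
      = ∫ u, u i * h u ∂(Measure.pi fun _ : Fin d => gaussianReal 0 1) := by
  obtain _ | n := d
  · exact i.elim0
  have hmp := (measurePreserving_piFinSuccAbove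
    (fun _ : Fin (n + 1) => gaussianReal 0 1) i).symm
  have hemb := (MeasurableEquiv.piFinSuccAbove (fun _ : Fin (n + 1) => ℝ) i).symm.measurableEmbedding
  have hcoe : ∀ p : ℝ × (Fin n → ℝ),
      (MeasurableEquiv.piFinSuccAbove (fun _ : Fin (n + 1) => ℝ) i).symm p
        = i.insertNth (α := fun _ => ℝ) p.1 p.2 := fun _ => rfl
  rw [← hmp.integrable_comp_emb hemb] at h0 h1 h2
  rw [← hmp.integral_comp hemb, ← hmp.integral_comp hemb]
  refine (integral_prod_symm _ h1).trans (Eq.trans ?_ (integral_prod_symm _ h2).symm)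
  refine integral_congr_ae ?_
  filter_upwards [h0.prod_left_ae, h1.prod_left_ae, h2.prod_left_ae] with v k0 k1 k2
  simp only [Function.comp_apply, hcoe, Fin.insertNth_apply_same] at k0 k1 k2 ⊢
  refine integral_deriv_gaussianReal (fun t => ?_) k0 k1 k2
  have hupd : (fun t : ℝ => i.insertNth (α := fun _ => ℝ) t v)
      = Function.update (i.insertNth (α := fun _ => ℝ) (0 : ℝ) v) i := by
    funext t
    simp
  have hd := hasDerivAt_update (𝕜 := ℝ) (i.insertNth (α := fun _ => ℝ) (0 : ℝ) v) i t
  rw [← hupd] at hd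
  exact (hh _).hasFDerivAt.comp_hasDerivAt t hd

end Stein

theorem integrable_norm_pow_pi_gaussianReal (d k : ℕ) :
    Integrable (fun u => ‖u‖ ^ k) (Measure.pi fun _ : Fin d => gaussianReal 0 1) := by
  have : MemLp (fun u : Fin d → ℝ => u) (k : ENNReal)
      (Measure.pi fun _ : Fin d => gaussianReal 0 1) :=
    MemLp.of_eval fun i => (memLp_id_gaussianReal' (k : ENNReal) (by simp)).comp_measurePreserving
      (measurePreserving_eval (fun _ : Fin d => gaussianReal 0 1) i)
  exact this.integrable_norm_pow'

section SparseGradient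

variable {ι : Type*} [Fintype ι] [DecidableEq ι] {f : (ι → ℝ) → ℝ}

/-- If at most one partial derivative is nonzero at each point, then a partial derivative which is
nonzero at `p` is constant on the coordinate hyperplane through `p`. -/
theorem fderiv_single_eq_of_apply_eq (hdiff : Differentiable ℝ f) (hcont : Continuous (fderiv ℝ f))
    (hs : ∀ x i j, fderiv ℝ f x (Pi.single i 1) ≠ 0 → fderiv ℝ f x (Pi.single j 1) ≠ 0 → i = j)
    {i : ι} {p : ι → ℝ} (hp : fderiv ℝ f p (Pi.single i 1) ≠ 0) {q : ι → ℝ} (hq : q i = p i) :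
    fderiv ℝ f q (Pi.single i 1) = fderiv ℝ f p (Pi.single i 1) := by
  have hci : Continuous fun z => fderiv ℝ f z (Pi.single i 1) := hcont.clm_apply continuous_const
  have hupd : Continuous fun z : ι → ℝ => Function.update z i (p i) :=
    continuous_id.update i continuous_const
  have local_const : ∀ w, fderiv ℝ f w (Pi.single i 1) ≠ 0 →
      ∃ ε > 0, ∀ w' ∈ Metric.ball w ε, w' i = w i →
        fderiv ℝ f w' (Pi.single i 1) = fderiv ℝ f w (Pi.single i 1) := by
    intro w hw
    obtain ⟨ε, hε, hball⟩ := Metric.isOpen_iff.1 (isOpen_ne_fun hci continuous_const) w hw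
    refine ⟨ε, hε, fun w' hw' hwi => ?_⟩
    have hzero : ∀ z ∈ Metric.ball w ε, fderiv ℝ f z (w' - w) = 0 := by
      intro z hz
      rw [pi_eq_sum_univ' (w' - w), map_sum]
      refine Finset.sum_eq_zero fun j _ => ?_
      rw [map_smul, smul_eq_mul]
      by_cases hj : j = i
      · subst hj; simp [hwi]
      · have : fderiv ℝ f z (Pi.single j 1) = 0 := by
          by_contra hne
          exact hj (hs z j i hne (hball hz))
        simp [this]
    have hev : (fun z => f (z + (w' - w))) =ᶠ[nhds w] f := by
      have hn1 : Metric.ball w ε ∈ nhds w := Metric.ball_mem_nhds w hε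
      have hn2 : ∀ᶠ z in nhds w, z + (w' - w) ∈ Metric.ball w ε := by
        refine (continuous_id.add continuous_const).continuousAt.eventually_mem
          (Metric.isOpen_ball.mem_nhds ?_)
        simpa using hw'
      filter_upwards [hn1, hn2] with z hz1 hz2
      obtain ⟨ζ, hζ, hmv⟩ := domain_mvt (f := f) (f' := fderiv ℝ f)
        (fun z _ => (hdiff z).hasFDerivAt.hasFDerivWithinAt) (convex_ball w ε) hz1 hz2
      rw [add_sub_cancel_left,
        hzero ζ ((convex_ball w ε).segment_subset hz1 hz2 hζ)] at hmv
      linarith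
    have := hev.fderiv_eq (𝕜 := ℝ)
    rw [fderiv_comp_add_right, add_sub_cancel] at this
    rw [this]
  have hclopen : IsClopen {z : ι → ℝ |
      fderiv ℝ f (Function.update z i (p i)) (Pi.single i 1) = fderiv ℝ f p (Pi.single i 1)} := by
    refine ⟨isClosed_eq (hci.comp hupd) continuous_const, isOpen_iff_mem_nhds.2 fun z hz => ?_⟩
    change fderiv ℝ f (Function.update z i (p i)) (Pi.single i 1) = _ at hz
    obtain ⟨ε, hε, hloc⟩ := local_const _ (hz ▸ hp)
    filter_upwards [hupd.continuousAt.eventually_mem (Metric.ball_mem_nhds _ hε)] with z' hz'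
    exact (hloc _ hz' (by simp)).trans hz
  have hmem := Set.eq_univ_iff_forall.1 (hclopen.eq_univ ⟨p, by simp⟩) q
  change fderiv ℝ f (Function.update q i (p i)) (Pi.single i 1) = _ at hmem
  rwa [← hq, Function.update_eq_self] at hmem

/-- A function whose gradient is everywhere `1`-sparse depends on a single coordinate. -/
theorem exists_forall_fderiv_single_eq_zero [Nonempty ι] (hdiff : Differentiable ℝ f)
    (hcont : Continuous (fderiv ℝ f))
    (hs : ∀ x i j, fderiv ℝ f x (Pi.single i 1) ≠ 0 → fderiv ℝ f x (Pi.single j 1) ≠ 0 → i = j) :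
    ∃ i, ∀ j, j ≠ i → ∀ z, fderiv ℝ f z (Pi.single j 1) = 0 := by
  by_cases hall : ∀ i z, fderiv ℝ f z (Pi.single i 1) = 0
  · exact ⟨Classical.arbitrary ι, fun j _ z => hall j z⟩
  push Not at hall
  obtain ⟨i, p, hp⟩ := hall
  refine ⟨i, fun j hji q => ?_⟩
  by_contra hq
  have h1 := fderiv_single_eq_of_apply_eq hdiff hcont hs hp
    (q := Function.update q i (p i)) (by simp)
  have h2 := fderiv_single_eq_of_apply_eq hdiff hcont hs hq
    (q := Function.update q i (p i)) (by simp [hji])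
  exact hji (hs _ j i (h2 ▸ hq) (h1 ▸ hp))

end SparseGradient

section Smoothing

variable {d : ℕ} {f : (Fin d → ℝ) → ℝ} {L : ℝ}

theorem hasFDerivAt_integral_add_smul {μ : Measure (Fin d → ℝ)} [IsProbabilityMeasure μ]
    (hμ1 : Integrable (fun u => ‖u‖) μ) (hμ2 : Integrable (fun u => ‖u‖ ^ 2) μ)
    (hL : 0 ≤ L) (hdiff : Differentiable ℝ f)
    (hlip : ∀ x y, |f y - f x - fderiv ℝ f x (y - x)| ≤ L / 2 * ‖y - x‖ ^ 2)
    (ν : ℝ) (x : Fin d → ℝ) :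
    HasFDerivAt (fun y => ∫ u, f (y + ν • u) ∂μ) (∫ u, fderiv ℝ f (x + ν • u) ∂μ) x := by
  have hmeas : ∀ y, AEStronglyMeasurable (fun u => f (y + ν • u)) μ := fun y =>
    (hdiff.continuous.comp (by fun_prop)).aestronglyMeasurable
  have haff : Measurable fun u : Fin d → ℝ => x + ν • u := by fun_prop
  refine hasFDerivAt_integral_of_dominated_of_fderiv_le
    (F' := fun y u => fderiv ℝ f (y + ν • u))
    (bound := fun u => ‖fderiv ℝ f x‖ + 2 * L * (1 + |ν| * ‖u‖))
    (Metric.ball_mem_nhds x one_pos) (Filter.Eventually.of_forall hmeas) ?_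
    ((measurable_fderiv ℝ f).comp haff).aestronglyMeasurable ?_ ?_ ?_
  · refine Integrable.mono' (g := fun u => |f x| + ‖fderiv ℝ f x‖ * |ν| * ‖u‖
      + L / 2 * ν ^ 2 * ‖u‖ ^ 2) ?_ (hmeas x) (Filter.Eventually.of_forall fun u => ?_)
    · exact ((integrable_const _).add (hμ1.const_mul _)).add (hμ2.const_mul _)
    · have h1 := hlip x (x + ν • u)
      rw [add_sub_cancel_left, norm_smul, mul_pow, Real.norm_eq_abs, sq_abs] at h1
      have h2 := (fderiv ℝ f x).le_opNorm (ν • u)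
      rw [norm_smul, Real.norm_eq_abs, Real.norm_eq_abs] at h2
      rw [Real.norm_eq_abs]
      have h3 : f (x + ν • u) = (f (x + ν • u) - f x - fderiv ℝ f x (ν • u)) + f x
          + fderiv ℝ f x (ν • u) := by ring
      rw [h3]
      refine (abs_add_three _ _ _).trans ?_
      linarith
  · refine Filter.Eventually.of_forall fun u y hy => ?_
    have h1 := norm_fderiv_sub_le hL hlip x (y + ν • u)
    have h2 : ‖y + ν • u - x‖ ≤ 1 + |ν| * ‖u‖ := by
      rw [add_sub_right_comm]
      refine (norm_add_le _ _).trans ?_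
      rw [norm_smul, Real.norm_eq_abs]
      have := mem_ball_iff_norm.1 hy
      linarith
    have h3 := norm_le_norm_add_norm_sub' (fderiv ℝ f (y + ν • u)) (fderiv ℝ f x)
    have h4 := mul_le_mul_of_nonneg_left h2 (by positivity : 0 ≤ 2 * L)
    linarith
  · exact (integrable_const _).add (((integrable_const _).add (hμ1.const_mul _)).const_mul _)
  · refine Filter.Eventually.of_forall fun u y _ => ?_
    exact (hasFDerivAt_comp_add_right (ν • u)).2 (hdiff _).hasFDerivAt

theorem norm_fderiv_add_smul_sub_le (hL : 0 ≤ L)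
    (hlip : ∀ x y, |f y - f x - fderiv ℝ f x (y - x)| ≤ L / 2 * ‖y - x‖ ^ 2)
    {ν : ℝ} (hν : 0 ≤ ν) (x u : Fin d → ℝ) :
    ‖fderiv ℝ f (x + ν • u) - fderiv ℝ f x‖ ≤ 2 * L * ν * ‖u‖ := by
  have := norm_fderiv_sub_le hL hlip x (x + ν • u)
  rw [add_sub_cancel_left, norm_smul, Real.norm_of_nonneg hν] at this
  linarith

theorem integrable_fderiv_add_smul_sub {μ : Measure (Fin d → ℝ)}
    (hμ1 : Integrable (fun u => ‖u‖) μ) (hL : 0 ≤ L)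
    (hlip : ∀ x y, |f y - f x - fderiv ℝ f x (y - x)| ≤ L / 2 * ‖y - x‖ ^ 2)
    {ν : ℝ} (hν : 0 ≤ ν) (x : Fin d → ℝ) :
    Integrable (fun u => fderiv ℝ f (x + ν • u) - fderiv ℝ f x) μ := by
  have haff : Measurable fun u : Fin d → ℝ => x + ν • u := by fun_prop
  refine (hμ1.const_mul (2 * L * ν)).mono'
    (((measurable_fderiv ℝ f).comp haff).sub_const _).aestronglyMeasurable
    (Filter.Eventually.of_forall fun u => norm_fderiv_add_smul_sub_le hL hlip hν x u)

/-- The smoothing bias of one partial derivative, bounded through Stein's identity applied to the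
first-order remainder. -/
theorem abs_integral_fderiv_sub_apply_single_le (hL : 0 ≤ L) (hdiff : Differentiable ℝ f)
    (hlip : ∀ x y, |f y - f x - fderiv ℝ f x (y - x)| ≤ L / 2 * ‖y - x‖ ^ 2)
    {ν : ℝ} (hν : 0 < ν) (x : Fin d → ℝ) (i : Fin d) :
    |∫ u, (fderiv ℝ f (x + ν • u) - fderiv ℝ f x) (Pi.single i 1)
        ∂(Measure.pi fun _ : Fin d => gaussianReal 0 1)|
      ≤ ν * L / 2 * ∫ u, ‖u‖ ^ 3 ∂(Measure.pi fun _ : Fin d => gaussianReal 0 1) := by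
  set μ := Measure.pi fun _ : Fin d => gaussianReal 0 1 with hμ
  have m1 : Integrable (fun u => ‖u‖) μ := by
    simpa using integrable_norm_pow_pi_gaussianReal d 1
  have m2 : Integrable (fun u => ‖u‖ ^ 2) μ := integrable_norm_pow_pi_gaussianReal d 2
  have m3 : Integrable (fun u => ‖u‖ ^ 3) μ := integrable_norm_pow_pi_gaussianReal d 3
  set r : (Fin d → ℝ) → ℝ := fun u => f (x + ν • u) - f x - fderiv ℝ f x (ν • u) with hr
  have hrd : ∀ u, HasFDerivAt r (ν • (fderiv ℝ f (x + ν • u) - fderiv ℝ f x)) u := by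
    intro u
    have hlin : HasFDerivAt (fun u : Fin d → ℝ => ν • u)
        (ν • ContinuousLinearMap.id ℝ (Fin d → ℝ)) u := (hasFDerivAt_id u).const_smul ν
    have h1 := (hdiff (x + ν • u)).hasFDerivAt.comp u (hlin.const_add x)
    have h2 := (fderiv ℝ f x).hasFDerivAt.comp u hlin
    refine ((h1.sub_const (f x)).sub h2).congr_fderiv ?_
    ext v
    simp [mul_sub]
  have hrdiff : Differentiable ℝ r := fun u => (hrd u).differentiableAt
  have hrb : ∀ u, |r u| ≤ L / 2 * ν ^ 2 * ‖u‖ ^ 2 := by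
    intro u
    have := hlip x (x + ν • u)
    rw [add_sub_cancel_left, norm_smul, mul_pow, Real.norm_eq_abs, sq_abs] at this
    rw [hr]
    linarith
  have hub : ∀ u, ‖u i * r u‖ ≤ L / 2 * ν ^ 2 * ‖u‖ ^ 3 := by
    intro u
    rw [norm_mul, Real.norm_eq_abs (r u)]
    have := mul_le_mul (norm_le_pi_norm u i) (hrb u) (abs_nonneg _) (norm_nonneg u)
    linarith
  have hi1 : Integrable (fun u => (fderiv ℝ f (x + ν • u) - fderiv ℝ f x) (Pi.single i 1)) μ :=
    (integrable_fderiv_add_smul_sub m1 hL hlip hν.le x).apply_continuousLinearMap _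
  have hfd : ∀ u, fderiv ℝ r u (Pi.single i 1)
      = ν * (fderiv ℝ f (x + ν • u) - fderiv ℝ f x) (Pi.single i 1) := by
    intro u
    rw [(hrd u).fderiv]
    rfl
  have stein := integral_fderiv_pi_gaussianReal hrdiff i
    ((m2.const_mul (L / 2 * ν ^ 2)).mono' hrdiff.continuous.aestronglyMeasurable
      (Filter.Eventually.of_forall hrb))
    (by simp only [hfd]; exact hi1.const_mul ν)
    ((m3.const_mul (L / 2 * ν ^ 2)).mono'
      ((continuous_apply i).mul hrdiff.continuous).aestronglyMeasurable
      (Filter.Eventually.of_forall hub))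
  simp only [hfd] at stein
  rw [integral_const_mul] at stein
  have hle := norm_integral_le_of_norm_le (m3.const_mul (L / 2 * ν ^ 2))
    (Filter.Eventually.of_forall hub)
  rw [← stein, integral_const_mul, norm_mul, Real.norm_of_nonneg hν.le, Real.norm_eq_abs] at hle
  refine le_of_mul_le_mul_left (hle.trans (le_of_eq ?_)) hν
  ring

end Smoothing

theorem sum_abs_apply_single_le_norm {ι : Type*} [Fintype ι] [DecidableEq ι]
    (T : (ι → ℝ) →L[ℝ] ℝ) : ∑ i, |T (Pi.single i 1)| ≤ ‖T‖ := by
  set σ : ι → ℝ := fun i => (SignType.sign (T (Pi.single i 1)) : ℝ) with hσ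
  have hnorm : ‖σ‖ ≤ 1 := by
    refine (pi_norm_le_iff_of_nonneg zero_le_one).2 fun i => ?_
    rcases SignType.trichotomy (SignType.sign (T (Pi.single i 1))) with h | h | h <;>
      simp [hσ, h]
  have hT : T σ = ∑ i, |T (Pi.single i 1)| := by
    conv_lhs => rw [pi_eq_sum_univ' σ, map_sum]
    refine Finset.sum_congr rfl fun i _ => ?_
    rw [map_smul, smul_eq_mul]
    exact sign_mul_self _
  calc ∑ i, |T (Pi.single i 1)| = T σ := hT.symm
    _ ≤ ‖T σ‖ := le_abs_self _
    _ ≤ ‖T‖ * ‖σ‖ := T.le_opNorm σ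
    _ ≤ ‖T‖ := mul_le_of_le_one_right (norm_nonneg _) hnorm

theorem stmt_8 (d s : ℕ) (hd : 2 ≤ d) (f : (Fin d → ℝ) → ℝ) (L ν C : ℝ)
    (hν : 0 < ν) (hL : 0 < L) (hC : 0 < C)
    (hdiff : Differentiable ℝ f)
    (hlip : ∀ x y, |f y - f x - fderiv ℝ f x (y - x)| ≤ L / 2 * ‖y - x‖ ^ 2)
    (hsparse : ∀ x : Fin d → ℝ,
      (Finset.univ.filter fun i => fderiv ℝ f x (Pi.single i 1) ≠ 0).card ≤ s)
    (hmom : ∀ k : ℕ, 1 ≤ k → k ≤ 3 →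
      ∫ u, ‖u‖ ^ k ∂(Measure.pi fun _ : Fin d => gaussianReal 0 1)
        ≤ C * (2 * Real.log d) ^ ((k : ℝ) / 2))
    (x : Fin d → ℝ) :
    Real.sqrt (∑ i : Fin d,
        (fderiv ℝ (fun y => ∫ u, f (y + ν • u)
              ∂(Measure.pi fun _ : Fin d => gaussianReal 0 1)) x (Pi.single i 1)
          - fderiv ℝ f x (Pi.single i 1)) ^ 2)
      ≤ C * ν * L * Real.sqrt (2 * s) * (Real.log d) ^ ((3 : ℝ) / 2) := by
  set μ := Measure.pi fun _ : Fin d => gaussianReal 0 1 with hμ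
  have m1 : Integrable (fun u => ‖u‖) μ := by
    simpa using integrable_norm_pow_pi_gaussianReal d 1
  have m2 : Integrable (fun u => ‖u‖ ^ 2) μ := integrable_norm_pow_pi_gaussianReal d 2
  have hgi := integrable_fderiv_add_smul_sub m1 hL.le hlip hν.le x
  set T : (Fin d → ℝ) →L[ℝ] ℝ := ∫ u, (fderiv ℝ f (x + ν • u) - fderiv ℝ f x) ∂μ with hT
  have hTapp : ∀ v, T v = ∫ u, (fderiv ℝ f (x + ν • u) - fderiv ℝ f x) v ∂μ :=
    fun v => ContinuousLinearMap.integral_apply hgi v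
  have hTeq : fderiv ℝ (fun y => ∫ u, f (y + ν • u) ∂μ) x - fderiv ℝ f x = T := by
    have hi : Integrable (fun u => fderiv ℝ f (x + ν • u)) μ := by
      refine (hgi.add (integrable_const (fderiv ℝ f x))).congr
        (Filter.Eventually.of_forall fun u => ?_)
      exact sub_add_cancel _ _
    rw [(hasFDerivAt_integral_add_smul m1 m2 hL.le hdiff hlip ν x).fderiv, hT,
      integral_sub hi (integrable_const _)]
    simp
  simp only [← sub_apply, hTeq]
  set ℓ := Real.log d with hℓ
  have hℓ0 : 0 < ℓ := Real.log_pos (by exact_mod_cast hd)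
  have hpow : ℓ ^ ((3 : ℝ) / 2) = ℓ * √ℓ := by
    rw [Real.sqrt_eq_rpow, ← Real.rpow_one_add' hℓ0.le (by norm_num)]
    norm_num
  have hmom1 : ∫ u, ‖u‖ ∂μ ≤ C * (√2 * √ℓ) := by
    have := hmom 1 le_rfl (by norm_num)
    simp only [pow_one] at this
    rwa [Nat.cast_one, ← Real.sqrt_eq_rpow, Real.sqrt_mul zero_le_two] at this
  have hmom3 : ∫ u, ‖u‖ ^ 3 ∂μ ≤ C * (2 * ℓ * (√2 * √ℓ)) := by
    have := hmom 3 (by norm_num) le_rfl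
    have e : (2 * ℓ) ^ (((3 : ℕ) : ℝ) / 2) = 2 * ℓ * (√2 * √ℓ) := by
      rw [← Real.sqrt_mul zero_le_two, Real.sqrt_eq_rpow,
        ← Real.rpow_one_add' (by positivity) (by norm_num)]
      norm_num
    rwa [e] at this
  set B := C * ν * L * √2 * (ℓ * √ℓ) with hB
  have hB0 : 0 ≤ B := by positivity
  have hTB : ∀ i, |T (Pi.single i 1)| ≤ B := by
    intro i
    rw [hTapp]
    refine (abs_integral_fderiv_sub_apply_single_le hL.le hdiff hlip hν x i).trans ?_
    refine (mul_le_mul_of_nonneg_left hmom3 (by positivity)).trans (le_of_eq ?_)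
    rw [hB]
    ring
  have hTnorm : ‖T‖ ≤ 2 * L * ν * (C * (√2 * √ℓ)) := by
    refine (norm_integral_le_of_norm_le (m1.const_mul (2 * L * ν))
      (Filter.Eventually.of_forall fun u =>
        norm_fderiv_add_smul_sub_le hL.le hlip hν.le x u)).trans ?_
    rw [integral_const_mul]
    exact mul_le_mul_of_nonneg_left hmom1 (by positivity)
  have hTzero : ∀ j, (∀ z, fderiv ℝ f z (Pi.single j 1) = 0) → T (Pi.single j 1) = 0 := by
    intro j hj
    rw [hTapp]
    simp [hj]
  suffices hsum : ∑ i, (T (Pi.single i 1)) ^ 2 ≤ s * B ^ 2 by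
    refine (Real.sqrt_le_sqrt hsum).trans (le_of_eq ?_)
    rw [Real.sqrt_mul (Nat.cast_nonneg s), Real.sqrt_sq hB0, Real.sqrt_mul zero_le_two, hpow, hB]
    ring
  have hsq : ∀ i, (T (Pi.single i 1)) ^ 2 ≤ B ^ 2 := fun i => sq_le_sq.2
    ((hTB i).trans (le_abs_self B))
  rcases Nat.lt_or_ge s 2 with hs2 | hs2
  · rcases Nat.eq_zero_or_pos s with rfl | hs0
    · have hz : ∀ i, T (Pi.single i 1) = 0 := fun i => hTzero i fun z => by
        have := Finset.card_eq_zero.1 (Nat.le_zero.1 (hsparse z))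
        by_contra hne
        exact Finset.notMem_empty i (this ▸ Finset.mem_filter.2 ⟨Finset.mem_univ i, hne⟩)
      simp [hz]
    · obtain rfl : s = 1 := by omega
      have : Nonempty (Fin d) := ⟨⟨0, by omega⟩⟩
      have hcont : Continuous (fderiv ℝ f) :=
        (LipschitzWith.of_dist_le_mul (K := (2 * L).toNNReal) fun a b => by
          rw [dist_eq_norm, dist_eq_norm, Real.coe_toNNReal _ (by positivity)]
          exact norm_fderiv_sub_le hL.le hlip b a).continuous
      obtain ⟨i, hi⟩ := exists_forall_fderiv_single_eq_zero hdiff hcont fun z a b ha hb =>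
        Finset.card_le_one.1 (hsparse z) a (by simpa using ha) b (by simpa using hb)
      rw [Finset.sum_eq_single i (fun j _ hj => by rw [hTzero j (hi j hj)]; norm_num)
        (fun h => absurd (Finset.mem_univ i) h)]
      simpa using hsq i
  · rcases Nat.lt_or_ge s d with hsd | hsd
    · have hℓ1 : 1 ≤ ℓ := by
        rw [hℓ, Real.le_log_iff_exp_le (by positivity)]
        have h3 : (3 : ℝ) ≤ d := by exact_mod_cast (by omega : 3 ≤ d)
        linarith [Real.exp_one_lt_d9]
      have hs2' : (2 : ℝ) ≤ s := by exact_mod_cast hs2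
      calc ∑ i, (T (Pi.single i 1)) ^ 2 ≤ ∑ i, B * |T (Pi.single i 1)| := by
            refine Finset.sum_le_sum fun i _ => ?_
            rw [← sq_abs, sq]
            exact mul_le_mul_of_nonneg_right (hTB i) (abs_nonneg _)
        _ = B * ∑ i, |T (Pi.single i 1)| := by rw [Finset.mul_sum]
        _ ≤ B * (2 * L * ν * (C * (√2 * √ℓ))) :=
            mul_le_mul_of_nonneg_left ((sum_abs_apply_single_le_norm T).trans hTnorm) hB0
        _ ≤ B * (s * B) := by
            refine mul_le_mul_of_nonneg_left ?_ hB0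
            have h2 : 2 * 1 ≤ s * ℓ := mul_le_mul hs2' hℓ1 zero_le_one (by positivity)
            calc 2 * L * ν * (C * (√2 * √ℓ)) = (2 * 1) * (C * ν * L * √2 * √ℓ) := by ring
              _ ≤ (s * ℓ) * (C * ν * L * √2 * √ℓ) :=
                  mul_le_mul_of_nonneg_right h2 (by positivity)
              _ = s * B := by rw [hB]; ring
        _ = s * B ^ 2 := by ring
    · calc ∑ i, (T (Pi.single i 1)) ^ 2 ≤ ∑ _i : Fin d, B ^ 2 :=
            Finset.sum_le_sum fun i _ => hsq i
        _ = d * B ^ 2 := by simp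
        _ ≤ s * B ^ 2 :=
            mul_le_mul_of_nonneg_right (by exact_mod_cast hsd) (sq_nonneg B)
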